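/- Let (Ω, ℰ, P) be a probability space, φ a continuous finite-valued Orlicz function with conjugate ψ(s) = ⨆_{t ≥ 0}(t·s − φ(t)). Equip the Orlicz heart H^φ with the Luxemburg norm |x|_{φL} = inf { λ > 0 : ∫_Ω φ(|x|/λ) dP ≤ 1 }, and for f ∈ L^ψ set |f|_{ψO} = sup { |∫_Ω f η dP| : η ∈ L^φ, |η|_{φL} ≤ 1 }. Then: (i) for every f ∈ L^ψ and every x ∈ H^φ, the product f·x is P-integrable, and the map T f : x ↦ ∫_Ω f x dP is a bounded linear functional on (H^φ, |·|_{φL}) with operator norm equal to |f|_{ψO}; (ii) conversely, for every bounded linear functional F on (H^φ, |·|_{φL}) there exists f ∈ L^ψ, unique up to a.e. equality, such that F(x) = ∫_Ω f x dP for all x ∈ H^φ. Hence T is an isometric isomorphism from (L^ψ, |·|_{ψO}) onto the continuous dual of (H^φ, |·|_{φL}). -/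

import Mathlib

open scoped ENNReal NNReal
open MeasureTheory

/-- The Luxemburg norm of `x` with respect to `φ` and `P` (with `inf ∅ = ∞`). -/
noncomputable def luxemburgNorm {Ω : Type*} [MeasurableSpace Ω] (P : Measure Ω)
    (φ : ℝ≥0 → ℝ≥0∞) (x : Ω → ℝ) : ℝ≥0∞ :=
  sInf {r : ℝ≥0∞ | ∃ l : ℝ≥0, 0 < l ∧ r = (l : ℝ≥0∞) ∧
    (∫⁻ ω, φ (‖x ω‖₊ / l) ∂P) ≤ 1}

/-- The Orlicz space `L^φ` (as a set of functions). -/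
def orliczSet {Ω : Type*} [MeasurableSpace Ω] (P : Measure Ω)
    (φ : ℝ≥0 → ℝ≥0∞) : Set (Ω → ℝ) :=
  {x | AEStronglyMeasurable x P ∧
    ∃ d : ℝ≥0, 0 < d ∧ (∫⁻ ω, φ (d * ‖x ω‖₊) ∂P) < ⊤}

/-- The Orlicz heart `H^φ` (as a set of functions). -/
def orliczHeart {Ω : Type*} [MeasurableSpace Ω] (P : Measure Ω)
    (φ : ℝ≥0 → ℝ≥0∞) : Set (Ω → ℝ) :=
  {x | AEStronglyMeasurable x P ∧
    ∀ d : ℝ≥0, 0 < d → (∫⁻ ω, φ (d * ‖x ω‖₊) ∂P) < ⊤}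

/-- The Orlicz (dual) norm `|f|_{φO}` of `f`: the supremum of `|∫ f η dP|` over
`η ∈ L^φ` with Luxemburg norm at most one. -/
noncomputable def orliczDualNorm {Ω : Type*} [MeasurableSpace Ω] (P : Measure Ω)
    (φ : ℝ≥0 → ℝ≥0∞) (f : Ω → ℝ) : ℝ≥0∞ :=
  sSup {r : ℝ≥0∞ | ∃ η ∈ orliczSet P φ, luxemburgNorm P φ η ≤ 1 ∧
    r = ENNReal.ofReal |∫ ω, f ω * η ω ∂P|}

section OrliczDuality

open Filter Topology

variable {Ω : Type*} [MeasurableSpace Ω] {P : Measure Ω} {φ ψ : ℝ≥0 → ℝ≥0∞}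

/-- Young's inequality for a function and its conjugate. -/
lemma mul_le_add_of_eq_conjugate
    (hψ : ∀ s : ℝ≥0, ψ s = ⨆ t : ℝ≥0, ((t : ℝ≥0∞) * (s : ℝ≥0∞) - φ t)) (t s : ℝ≥0) :
    (t : ℝ≥0∞) * s ≤ φ t + ψ s := by
  rw [← tsub_le_iff_left, hψ]
  exact le_iSup (fun t : ℝ≥0 => (t : ℝ≥0∞) * (s : ℝ≥0∞) - φ t) t

/-- Young's inequality in integrated form. -/
lemma mul_lintegral_enorm_mul_le (hmono : Monotone φ)
    (hψ : ∀ s : ℝ≥0, ψ s = ⨆ t : ℝ≥0, ((t : ℝ≥0∞) * (s : ℝ≥0∞) - φ t))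
    {f x : Ω → ℝ} (hx : AEStronglyMeasurable x P) (d e : ℝ≥0) :
    ((d * e : ℝ≥0) : ℝ≥0∞) * ∫⁻ ω, ‖f ω * x ω‖ₑ ∂P ≤
      (∫⁻ ω, φ (e * ‖x ω‖₊) ∂P) + ∫⁻ ω, ψ (d * ‖f ω‖₊) ∂P := by
  have hm : AEMeasurable (fun ω => φ (e * ‖x ω‖₊)) P :=
    hmono.measurable.comp_aemeasurable (hx.aemeasurable.nnnorm.const_mul e)
  rw [← lintegral_add_left' hm, ← lintegral_const_mul' _ _ ENNReal.coe_ne_top]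
  refine lintegral_mono fun ω => le_trans (le_of_eq ?_)
    (mul_le_add_of_eq_conjugate hψ (e * ‖x ω‖₊) (d * ‖f ω‖₊))
  rw [enorm_mul, enorm_eq_nnnorm, enorm_eq_nnnorm]
  push_cast
  ring

lemma integrable_mul_of_mem_orliczSet (hmono : Monotone φ)
    (hψ : ∀ s : ℝ≥0, ψ s = ⨆ t : ℝ≥0, ((t : ℝ≥0∞) * (s : ℝ≥0∞) - φ t))
    {f x : Ω → ℝ} (hf : f ∈ orliczSet P ψ) (hx : x ∈ orliczSet P φ) :
    Integrable (fun ω => f ω * x ω) P := by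
  obtain ⟨hfm, d, hd, hfd⟩ := hf
  obtain ⟨hxm, e, he, hxe⟩ := hx
  refine ⟨hfm.mul hxm, ?_⟩
  have h := (mul_lintegral_enorm_mul_le hmono hψ (f := f) hxm d e).trans_lt
    (ENNReal.add_lt_top.2 ⟨hxe, hfd⟩)
  exact ENNReal.lt_top_of_mul_ne_top_right h.ne (by simp [hd.ne', he.ne'])

lemma orliczHeart_subset_orliczSet : orliczHeart P φ ⊆ orliczSet P φ :=
  fun _ hx => ⟨hx.1, 1, one_pos, hx.2 1 one_pos⟩

lemma mem_orliczHeart_of_nnnorm_le (hmono : Monotone φ) {x y : Ω → ℝ}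
    (hx : x ∈ orliczHeart P φ) (hy : AEStronglyMeasurable y P) {c : ℝ≥0} (hc : 0 < c)
    (h : ∀ᵐ ω ∂P, ‖y ω‖₊ ≤ c * ‖x ω‖₊) : y ∈ orliczHeart P φ := by
  refine ⟨hy, fun d hd => lt_of_le_of_lt (lintegral_mono_ae ?_) (hx.2 (d * c) (by positivity))⟩
  filter_upwards [h] with ω hω
  exact hmono (by rw [mul_assoc]; gcongr)

lemma mem_orliczHeart_of_bounded [IsFiniteMeasure P] (hmono : Monotone φ)
    (hfin : ∀ t : ℝ≥0, φ t < ⊤) {y : Ω → ℝ} (hy : AEStronglyMeasurable y P) (c : ℝ≥0)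
    (h : ∀ ω, ‖y ω‖₊ ≤ c) : y ∈ orliczHeart P φ := by
  refine ⟨hy, fun d _ => lt_of_le_of_lt
    (lintegral_mono (g := fun _ => φ (d * c)) fun ω => hmono (by gcongr; exact h ω)) ?_⟩
  rw [lintegral_const]
  exact ENNReal.mul_lt_top (hfin _) (measure_lt_top _ _)

lemma luxemburgNorm_le {x : Ω → ℝ} {l : ℝ≥0} (hl : 0 < l)
    (h : ∫⁻ ω, φ (‖x ω‖₊ / l) ∂P ≤ 1) : luxemburgNorm P φ x ≤ l :=
  sInf_le ⟨l, hl, rfl, h⟩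

lemma exists_lt_of_luxemburgNorm_lt {x : Ω → ℝ} {r : ℝ≥0∞} (h : luxemburgNorm P φ x < r) :
    ∃ l : ℝ≥0, 0 < l ∧ (l : ℝ≥0∞) < r ∧ ∫⁻ ω, φ (‖x ω‖₊ / l) ∂P ≤ 1 := by
  obtain ⟨_, ⟨l, hl, rfl, hle⟩, hlt⟩ := sInf_lt_iff.1 h
  exact ⟨l, hl, hlt, hle⟩

lemma luxemburgNorm_mono (hmono : Monotone φ) {x y : Ω → ℝ} (h : ∀ ω, ‖y ω‖₊ ≤ ‖x ω‖₊) :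
    luxemburgNorm P φ y ≤ luxemburgNorm P φ x := by
  refine le_sInf ?_
  rintro _ ⟨l, hl, rfl, hle⟩
  exact luxemburgNorm_le hl ((lintegral_mono fun ω => hmono (by gcongr; exact h ω)).trans hle)

lemma tendsto_luxemburgNorm_zero {ι : Type*} {l : Filter ι} {y : ι → Ω → ℝ}
    (h : ∀ c : ℝ≥0, 0 < c → Tendsto (fun i => ∫⁻ ω, φ (c * ‖y i ω‖₊) ∂P) l (𝓝 0)) :
    Tendsto (fun i => luxemburgNorm P φ (y i)) l (𝓝 0) := by
  rw [ENNReal.tendsto_nhds_zero]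
  intro ε hε
  obtain ⟨r, hr0, hr⟩ := ENNReal.lt_iff_exists_nnreal_btwn.1 hε
  have hr0' : 0 < r := by exact_mod_cast hr0
  filter_upwards [(ENNReal.tendsto_nhds_zero.1 (h r⁻¹ (by positivity))) 1 one_pos] with i hi
  refine (luxemburgNorm_le hr0' ?_).trans hr.le
  simpa only [div_eq_inv_mul] using hi

lemma ofReal_abs_integral_le_lintegral_enorm (g : Ω → ℝ) :
    ENNReal.ofReal |∫ ω, g ω ∂P| ≤ ∫⁻ ω, ‖g ω‖ₑ ∂P := by
  rw [← Real.norm_eq_abs, ofReal_norm]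
  exact enorm_integral_le_lintegral_enorm g

lemma orliczDualNorm_lt_top (hmono : Monotone φ)
    (hψ : ∀ s : ℝ≥0, ψ s = ⨆ t : ℝ≥0, ((t : ℝ≥0∞) * (s : ℝ≥0∞) - φ t))
    {f : Ω → ℝ} (hf : f ∈ orliczSet P ψ) : orliczDualNorm P φ f < ⊤ := by
  obtain ⟨-, d, hd, hfd⟩ := hf
  set K : ℝ≥0∞ := 1 + ∫⁻ ω, ψ (d * ‖f ω‖₊) ∂P with hK
  have hKtop : K < ⊤ := ENNReal.add_lt_top.2 ⟨ENNReal.one_lt_top, hfd⟩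
  have hc : ((d * 2⁻¹ : ℝ≥0) : ℝ≥0∞) ≠ 0 := by simp [hd.ne']
  refine lt_of_le_of_lt (sSup_le ?_) (ENNReal.div_lt_top hKtop.ne hc)
  rintro _ ⟨η, hη, hle, rfl⟩
  refine (ofReal_abs_integral_le_lintegral_enorm _).trans ?_
  rw [ENNReal.le_div_iff_mul_le (Or.inl hc) (Or.inl ENNReal.coe_ne_top), mul_comm]
  refine (mul_lintegral_enorm_mul_le hmono hψ hη.1 d 2⁻¹).trans ?_
  obtain ⟨l, hl, hl2, hl1⟩ :=
    exists_lt_of_luxemburgNorm_lt (hle.trans_lt (show (1 : ℝ≥0∞) < (2 : ℝ≥0) by norm_num))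
  rw [hK]
  gcongr
  refine le_trans (lintegral_mono fun ω => hmono ?_) hl1
  rw [div_eq_inv_mul]
  gcongr
  exact_mod_cast hl2.le

lemma apply_div_le (hzero : φ 0 = 0)
    (hconv : ∀ a b u v : ℝ≥0, u + v = 1 →
      φ (u * a + v * b) ≤ (u : ℝ≥0∞) * φ a + (v : ℝ≥0∞) * φ b)
    (t : ℝ≥0) {l : ℝ≥0} (hl : 1 ≤ l) : φ (t / l) ≤ ((l⁻¹ : ℝ≥0) : ℝ≥0∞) * φ t := by
  have h := hconv t 0 l⁻¹ (1 - l⁻¹) (add_tsub_cancel_of_le (inv_le_one_of_one_le₀ hl))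
  simpa [hzero, div_eq_inv_mul] using h

lemma luxemburgNorm_le_one_add_lintegral (hzero : φ 0 = 0)
    (hconv : ∀ a b u v : ℝ≥0, u + v = 1 →
      φ (u * a + v * b) ≤ (u : ℝ≥0∞) * φ a + (v : ℝ≥0∞) * φ b) (x : Ω → ℝ) :
    luxemburgNorm P φ x ≤ 1 + ∫⁻ ω, φ ‖x ω‖₊ ∂P := by
  by_cases htop : ∫⁻ ω, φ ‖x ω‖₊ ∂P = ⊤
  · simp [htop]
  obtain ⟨m, hm⟩ : ∃ m : ℝ≥0, (m : ℝ≥0∞) = ∫⁻ ω, φ ‖x ω‖₊ ∂P := ⟨_, ENNReal.coe_toNNReal htop⟩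
  have hl : (1 : ℝ≥0) ≤ 1 + m := le_add_of_nonneg_right m.2
  have hl0 : (0 : ℝ≥0) < 1 + m := zero_lt_one.trans_le hl
  rw [← hm]
  refine luxemburgNorm_le (l := 1 + m) hl0 ?_
  refine (lintegral_mono fun ω => apply_div_le hzero hconv ‖x ω‖₊ hl).trans ?_
  rw [lintegral_const_mul' _ _ ENNReal.coe_ne_top, ← hm]
  norm_cast
  rw [inv_mul_le_iff₀ hl0, mul_one]
  exact le_add_of_nonneg_left zero_le_one

lemma ofReal_abs_integral_le_orliczDualNorm_mul (hzero : φ 0 = 0) (hmono : Monotone φ)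
    (hconv : ∀ a b u v : ℝ≥0, u + v = 1 →
      φ (u * a + v * b) ≤ (u : ℝ≥0∞) * φ a + (v : ℝ≥0∞) * φ b)
    (hψ : ∀ s : ℝ≥0, ψ s = ⨆ t : ℝ≥0, ((t : ℝ≥0∞) * (s : ℝ≥0∞) - φ t))
    {f x : Ω → ℝ} (hf : f ∈ orliczSet P ψ) (hx : x ∈ orliczHeart P φ) :
    ENNReal.ofReal |∫ ω, f ω * x ω ∂P| ≤ orliczDualNorm P φ f * luxemburgNorm P φ x := by
  have key : ∀ l : ℝ≥0, 0 < l → ∫⁻ ω, φ (‖x ω‖₊ / l) ∂P ≤ 1 →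
      ENNReal.ofReal |∫ ω, f ω * x ω ∂P| ≤ l * orliczDualNorm P φ f := by
    intro l hl hle
    have hl' : (0 : ℝ) < l := hl
    have hη : (fun ω => (l : ℝ)⁻¹ * x ω) ∈ orliczHeart P φ :=
      mem_orliczHeart_of_nnnorm_le hmono hx (hx.1.const_mul _) (c := l⁻¹) (by positivity)
        (Eventually.of_forall fun ω => by simp [nnnorm_mul])
    have hη1 : luxemburgNorm P φ (fun ω => (l : ℝ)⁻¹ * x ω) ≤ 1 := by
      refine luxemburgNorm_le one_pos ?_
      simpa [nnnorm_mul, div_eq_inv_mul] using hle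
    have hint : ∫ ω, f ω * x ω ∂P = l * ∫ ω, f ω * ((l : ℝ)⁻¹ * x ω) ∂P := by
      rw [← integral_const_mul]
      refine integral_congr_ae (Eventually.of_forall fun ω => ?_)
      field_simp
    rw [hint, abs_mul, abs_of_pos hl', ENNReal.ofReal_mul hl'.le, ENNReal.ofReal_coe_nnreal]
    gcongr
    exact le_sSup ⟨_, orliczHeart_subset_orliczSet hη, hη1, rfl⟩
  have hD := (orliczDualNorm_lt_top hmono hψ hf).ne
  rcases eq_or_ne (orliczDualNorm P φ f) 0 with hD0 | hD0
  · have hlt : luxemburgNorm P φ x < ⊤ :=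
      (luxemburgNorm_le_one_add_lintegral hzero hconv x).trans_lt
        (ENNReal.add_lt_top.2 ⟨ENNReal.one_lt_top, by simpa using hx.2 1 one_pos⟩)
    obtain ⟨l, hl, -, hle⟩ := exists_lt_of_luxemburgNorm_lt hlt
    simpa [hD0] using key l hl hle
  · rw [mul_comm, ← ENNReal.div_le_iff hD0 hD]
    refine le_sInf ?_
    rintro _ ⟨l, hl, rfl, hle⟩
    rw [ENNReal.div_le_iff hD0 hD]
    exact key l hl hle

lemma sSup_orliczHeart_eq_orliczDualNorm [IsFiniteMeasure P] (hmono : Monotone φ)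
    (hfin : ∀ t : ℝ≥0, φ t < ⊤)
    (hψ : ∀ s : ℝ≥0, ψ s = ⨆ t : ℝ≥0, ((t : ℝ≥0∞) * (s : ℝ≥0∞) - φ t))
    {f : Ω → ℝ} (hf : f ∈ orliczSet P ψ) :
    sSup {r : ℝ≥0∞ | ∃ x ∈ orliczHeart P φ, luxemburgNorm P φ x ≤ 1 ∧
      r = ENNReal.ofReal |∫ ω, f ω * x ω ∂P|} = orliczDualNorm P φ f := by
  refine le_antisymm (sSup_le_sSup ?_) (sSup_le ?_)
  · rintro _ ⟨x, hx, hx1, rfl⟩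
    exact ⟨x, orliczHeart_subset_orliczSet hx, hx1, rfl⟩
  rintro _ ⟨η, hη, hη1, rfl⟩
  let T : ℕ → Ω → ℝ := fun n ω => max (-(n : ℝ)) (min (η ω) n)
  have hTm : ∀ n, AEStronglyMeasurable (T n) P := fun n =>
    aestronglyMeasurable_const.sup (hη.1.inf aestronglyMeasurable_const)
  have hTn : ∀ n ω, |T n ω| ≤ n := fun n ω =>
    abs_le.2 ⟨le_max_left _ _, max_le (by linarith [n.cast_nonneg (α := ℝ)]) (min_le_right _ _)⟩
  have hTη : ∀ n ω, |T n ω| ≤ |η ω| := by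
    intro n ω
    have hn : (0 : ℝ) ≤ n := n.cast_nonneg
    refine abs_le.2 ⟨le_max_of_le_right (le_min (neg_abs_le _) ?_), max_le ?_ ?_⟩
    · linarith [abs_nonneg (η ω)]
    · linarith [abs_nonneg (η ω)]
    · exact (min_le_left _ _).trans (le_abs_self _)
  have hT_lim : ∀ ω, Tendsto (fun n => T n ω) atTop (𝓝 (η ω)) := by
    intro ω
    obtain ⟨N, hN⟩ := exists_nat_ge |η ω|
    refine tendsto_const_nhds.congr' ?_
    filter_upwards [eventually_ge_atTop N] with n hn
    have hle : |η ω| ≤ n := hN.trans (by exact_mod_cast hn)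
    simp only [T]
    rw [min_eq_left (abs_le.1 hle).2, max_eq_right (abs_le.1 hle).1]
  have hlim : Tendsto (fun n => ∫ ω, f ω * T n ω ∂P) atTop (𝓝 (∫ ω, f ω * η ω ∂P)) := by
    refine tendsto_integral_of_dominated_convergence (fun ω => ‖f ω * η ω‖)
      (fun n => hf.1.mul (hTm n)) (integrable_mul_of_mem_orliczSet hmono hψ hf hη).norm
      (fun n => Eventually.of_forall fun ω => ?_)
      (Eventually.of_forall fun ω => (hT_lim ω).const_mul _)
    rw [norm_mul, norm_mul]
    exact mul_le_mul_of_nonneg_left (hTη n ω) (norm_nonneg _)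
  refine le_of_tendsto ((ENNReal.continuous_ofReal.tendsto _).comp hlim.abs)
    (Eventually.of_forall fun n => ?_)
  refine le_sSup ⟨T n, ?_, ?_, rfl⟩
  · exact mem_orliczHeart_of_bounded hmono hfin (hTm n) n fun ω => hTn n ω
  · exact (luxemburgNorm_mono hmono fun ω => hTη n ω).trans hη1

/-- `F` restricts to a bounded linear functional on the Orlicz heart. -/
structure IsBoundedLinearOnHeart (P : Measure Ω) (φ : ℝ≥0 → ℝ≥0∞) (F : (Ω → ℝ) → ℝ) : Prop where
  add : ∀ x ∈ orliczHeart P φ, ∀ y ∈ orliczHeart P φ, F (x + y) = F x + F y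
  smul : ∀ a : ℝ, ∀ x ∈ orliczHeart P φ, F (a • x) = a * F x
  bound : ∃ C : ℝ≥0, ∀ x ∈ orliczHeart P φ,
    ENNReal.ofReal |F x| ≤ (C : ℝ≥0∞) * luxemburgNorm P φ x

lemma IsBoundedLinearOnHeart.tendsto_zero {F : (Ω → ℝ) → ℝ} (hF : IsBoundedLinearOnHeart P φ F)
    {ι : Type*} {l : Filter ι} {y : ι → Ω → ℝ} (hy : ∀ i, y i ∈ orliczHeart P φ)
    (h : ∀ c : ℝ≥0, 0 < c → Tendsto (fun i => ∫⁻ ω, φ (c * ‖y i ω‖₊) ∂P) l (𝓝 0)) :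
    Tendsto (fun i => F (y i)) l (𝓝 0) := by
  obtain ⟨C, hC⟩ := hF.bound
  have h1 : Tendsto (fun i => (C : ℝ≥0∞) * luxemburgNorm P φ (y i)) l (𝓝 0) := by
    simpa using ENNReal.Tendsto.const_mul (tendsto_luxemburgNorm_zero h)
      (Or.inr (ENNReal.coe_ne_top (r := C)))
  have h2 : Tendsto (fun i => ENNReal.ofReal |F (y i)|) l (𝓝 0) :=
    tendsto_of_tendsto_of_tendsto_of_le_of_le tendsto_const_nhds h1 (fun _ => zero_le)
      fun i => hC _ (hy i)
  have h3 := (ENNReal.tendsto_toReal ENNReal.zero_ne_top).comp h2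
  refine (tendsto_zero_iff_abs_tendsto_zero _).2 ?_
  simpa [Function.comp_def, ENNReal.toReal_ofReal] using h3

lemma lintegral_apply_mul_nnnorm_indicator (hzero : φ 0 = 0) {A : Set Ω} (hA : MeasurableSet A)
    (c : ℝ≥0) : ∫⁻ ω, φ (c * ‖A.indicator (1 : Ω → ℝ) ω‖₊) ∂P = φ c * P A := by
  rw [← lintegral_indicator_const hA]
  refine lintegral_congr fun ω => ?_
  by_cases h : ω ∈ A <;> simp [h, hzero]

lemma indicator_one_mem_orliczHeart [IsFiniteMeasure P] (hmono : Monotone φ)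
    (hfin : ∀ t : ℝ≥0, φ t < ⊤) {A : Set Ω} (hA : MeasurableSet A) :
    A.indicator (1 : Ω → ℝ) ∈ orliczHeart P φ := by
  refine mem_orliczHeart_of_bounded hmono hfin
    (stronglyMeasurable_one.indicator hA).aestronglyMeasurable 1 fun ω => ?_
  by_cases h : ω ∈ A <;> simp [h]

lemma simpleFunc_mem_orliczHeart [IsFiniteMeasure P] (hmono : Monotone φ)
    (hfin : ∀ t : ℝ≥0, φ t < ⊤) (s : SimpleFunc Ω ℝ) : (s : Ω → ℝ) ∈ orliczHeart P φ := by
  obtain ⟨C, hC⟩ := s.exists_forall_norm_le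
  exact mem_orliczHeart_of_bounded hmono hfin s.stronglyMeasurable.aestronglyMeasurable C.toNNReal
    fun ω => NNReal.le_toNNReal_of_coe_le (hC ω)

namespace IsBoundedLinearOnHeart

variable [IsFiniteMeasure P] {F : (Ω → ℝ) → ℝ}

lemma map_indicator_union (hF : IsBoundedLinearOnHeart P φ F) (hmono : Monotone φ)
    (hfin : ∀ t : ℝ≥0, φ t < ⊤) {A B : Set Ω} (hA : MeasurableSet A) (hB : MeasurableSet B)
    (h : Disjoint A B) :
    F ((A ∪ B).indicator 1) = F (A.indicator 1) + F (B.indicator 1) := by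
  rw [Set.indicator_union_of_disjoint h,
    ← hF.add _ (indicator_one_mem_orliczHeart hmono hfin hA) _
      (indicator_one_mem_orliczHeart hmono hfin hB)]
  rfl

lemma map_indicator_empty (hF : IsBoundedLinearOnHeart P φ F) (hmono : Monotone φ)
    (hfin : ∀ t : ℝ≥0, φ t < ⊤) : F ((∅ : Set Ω).indicator 1) = 0 := by
  have := hF.map_indicator_union hmono hfin (A := ∅) (B := ∅) .empty .empty disjoint_bot_left
  rw [Set.union_empty] at this
  linarith

lemma map_indicator_biUnion (hF : IsBoundedLinearOnHeart P φ F) (hmono : Monotone φ)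
    (hfin : ∀ t : ℝ≥0, φ t < ⊤) {A : ℕ → Set Ω} (hA : ∀ i, MeasurableSet (A i))
    (hd : Pairwise (Function.onFun Disjoint A)) (s : Finset ℕ) :
    F ((⋃ i ∈ s, A i).indicator 1) = ∑ i ∈ s, F ((A i).indicator 1) := by
  induction s using Finset.induction_on with
  | empty => simpa using hF.map_indicator_empty hmono hfin
  | insert a s ha ih =>
    rw [Finset.set_biUnion_insert, Finset.sum_insert ha,
      hF.map_indicator_union hmono hfin (hA a) (s.measurableSet_biUnion fun i _ => hA i) ?_, ih]
    exact Set.disjoint_iUnion₂_right.2 fun i hi => hd (ne_of_mem_of_not_mem hi ha).symm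

lemma hasSum_map_indicator (hF : IsBoundedLinearOnHeart P φ F) (hzero : φ 0 = 0)
    (hmono : Monotone φ) (hfin : ∀ t : ℝ≥0, φ t < ⊤) {A : ℕ → Set Ω}
    (hA : ∀ i, MeasurableSet (A i)) (hd : Pairwise (Function.onFun Disjoint A)) :
    HasSum (fun i => F ((A i).indicator 1)) (F ((⋃ i, A i).indicator 1)) := by
  have hU : MeasurableSet (⋃ i, A i) := .iUnion hA
  have hV : ∀ s : Finset ℕ, MeasurableSet (⋃ i ∈ s, A i) :=
    fun s => s.measurableSet_biUnion fun i _ => hA i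
  have hsub : ∀ s : Finset ℕ, (⋃ i ∈ s, A i) ⊆ ⋃ i, A i :=
    fun s => Set.iUnion₂_subset fun i _ => Set.subset_iUnion A i
  have hP : Tendsto (fun s : Finset ℕ => P ((⋃ i, A i) \ ⋃ i ∈ s, A i)) atTop (𝓝 0) := by
    have hsum : Tendsto (fun s : Finset ℕ => ∑ i ∈ s, P (A i)) atTop (𝓝 (P (⋃ i, A i))) := by
      rw [measure_iUnion hd hA]
      exact ENNReal.summable.hasSum
    have := ENNReal.Tendsto.sub (tendsto_const_nhds (x := P (⋃ i, A i))) hsum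
      (Or.inl (measure_ne_top P _))
    rw [tsub_self] at this
    refine this.congr fun s => ?_
    rw [measure_sdiff (hsub s) (hV s).nullMeasurableSet (measure_ne_top _ _),
      measure_biUnion_finset (fun i _ j _ hij => hd hij) fun i _ => hA i]
  have h0 : Tendsto (fun s : Finset ℕ => F (((⋃ i, A i) \ ⋃ i ∈ s, A i).indicator 1))
      atTop (𝓝 0) := by
    refine hF.tendsto_zero
      (fun s => indicator_one_mem_orliczHeart hmono hfin (hU.diff (hV s))) fun c _ => ?_
    simp only [lintegral_apply_mul_nnnorm_indicator hzero (hU.diff (hV _))]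
    simpa using ENNReal.Tendsto.const_mul hP (Or.inr (hfin c).ne)
  have h1 := (tendsto_const_nhds (x := F ((⋃ i, A i).indicator 1))).sub h0
  rw [sub_zero] at h1
  refine Tendsto.congr (fun s => ?_) h1
  have := hF.map_indicator_union hmono hfin (hU.diff (hV s)) (hV s) Set.disjoint_sdiff_left
  rw [Set.sdiff_union_of_subset (hsub s)] at this
  rw [this, ← hF.map_indicator_biUnion hmono hfin hA hd s]
  ring

lemma map_indicator_eq_zero (hF : IsBoundedLinearOnHeart P φ F) (hzero : φ 0 = 0)
    (hmono : Monotone φ) (hfin : ∀ t : ℝ≥0, φ t < ⊤) {A : Set Ω} (hA : MeasurableSet A)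
    (h : P A = 0) : F (A.indicator 1) = 0 := by
  refine tendsto_nhds_unique (tendsto_const_nhds (f := (atTop : Filter ℕ))) (hF.tendsto_zero
    (fun _ => indicator_one_mem_orliczHeart hmono hfin hA) fun c _ => ?_)
  simp [lintegral_apply_mul_nnnorm_indicator hzero hA, h]

open Classical in
lemma exists_density (hF : IsBoundedLinearOnHeart P φ F) (hzero : φ 0 = 0)
    (hmono : Monotone φ) (hfin : ∀ t : ℝ≥0, φ t < ⊤) :
    ∃ f : Ω → ℝ, Measurable f ∧ Integrable f P ∧
      ∀ A, MeasurableSet A → F (A.indicator 1) = ∫ ω in A, f ω ∂P := by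
  let ν : SignedMeasure Ω :=
    { measureOf' := fun A => if MeasurableSet A then F (A.indicator 1) else 0
      empty' := by simpa using hF.map_indicator_empty hmono hfin
      not_measurable' := fun A hA => if_neg hA
      m_iUnion' := fun A hA hd => by
        simpa only [if_pos (hA _), if_pos (MeasurableSet.iUnion hA)] using
          hF.hasSum_map_indicator hzero hmono hfin hA hd }
  have hν : ∀ A, MeasurableSet A → ν A = F (A.indicator 1) := fun A hA => if_pos hA
  have hac : VectorMeasure.AbsolutelyContinuous ν P.toENNRealVectorMeasure := by
    refine VectorMeasure.AbsolutelyContinuous.mk fun A hA h => ?_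
    rw [Measure.toENNRealVectorMeasure_apply_measurable hA] at h
    rw [hν A hA, hF.map_indicator_eq_zero hzero hmono hfin hA h]
  refine ⟨ν.rnDeriv P, SignedMeasure.measurable_rnDeriv _ _, SignedMeasure.integrable_rnDeriv _ _,
    fun A hA => ?_⟩
  rw [← withDensityᵥ_apply (SignedMeasure.integrable_rnDeriv ν P) hA,
    SignedMeasure.withDensityᵥ_rnDeriv_eq ν P hac, hν A hA]

lemma map_simpleFunc (hF : IsBoundedLinearOnHeart P φ F) (hmono : Monotone φ)
    (hfin : ∀ t : ℝ≥0, φ t < ⊤) {f : Ω → ℝ} (hf : Integrable f P)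
    (hfF : ∀ A, MeasurableSet A → F (A.indicator 1) = ∫ ω in A, f ω ∂P) (s : SimpleFunc Ω ℝ) :
    Integrable (fun ω => f ω * s ω) P ∧ F s = ∫ ω, f ω * s ω ∂P := by
  have hint : ∀ s : SimpleFunc Ω ℝ, Integrable (fun ω => f ω * s ω) P := by
    intro s
    obtain ⟨C, hC⟩ := s.exists_forall_norm_le
    exact hf.mul_bdd s.stronglyMeasurable.aestronglyMeasurable (Eventually.of_forall hC)
  refine ⟨hint s, ?_⟩
  induction s using SimpleFunc.induction with
  | const c hs =>
    rename_i A
    have h1 : (SimpleFunc.piecewise A hs (SimpleFunc.const Ω c) (SimpleFunc.const Ω 0) : Ω → ℝ)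
        = c • A.indicator 1 := by
      ext ω
      by_cases h : ω ∈ A <;> simp [h]
    rw [h1, hF.smul c _ (indicator_one_mem_orliczHeart hmono hfin hs), hfF A hs,
      ← integral_indicator hs, ← integral_const_mul]
    refine integral_congr_ae (Eventually.of_forall fun ω => ?_)
    by_cases h : ω ∈ A <;> simp [h, mul_comm]
  | add _ ih1 ih2 =>
    rename_i s t _
    rw [SimpleFunc.coe_add, hF.add _ (simpleFunc_mem_orliczHeart hmono hfin s) _
      (simpleFunc_mem_orliczHeart hmono hfin t), ih1, ih2, ← integral_add (hint s) (hint t)]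
    simp only [Pi.add_apply, mul_add]

end IsBoundedLinearOnHeart

/-- A finite supremum of the affine functions defining the conjugate is attained by a
simple function. -/
lemma exists_simpleFunc_maximizer (hφ : Measurable φ) (hzero : φ 0 = 0) (q : ℕ → ℝ≥0) (n : ℕ) :
    ∃ σ : SimpleFunc ℝ≥0 ℝ≥0, ∀ s, φ (σ s) ≤ σ s * s ∧
      ∀ k < n, (q k : ℝ≥0∞) * s - φ (q k) ≤ σ s * s - φ (σ s) := by
  induction n with
  | zero => exact ⟨SimpleFunc.const _ 0, fun s => by simp [hzero]⟩
  | succ n ih =>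
    obtain ⟨σ, hσ⟩ := ih
    have hm : MeasurableSet {s : ℝ≥0 |
        (σ s : ℝ≥0∞) * s - φ (σ s) < (q n : ℝ≥0∞) * s - φ (q n)} := by
      have h1 : Measurable fun s : ℝ≥0 => (σ s : ℝ≥0∞) * s - φ (σ s) :=
        (σ.measurable.coe_nnreal_ennreal.mul measurable_coe_nnreal_ennreal).sub
          (hφ.comp σ.measurable)
      have h2 : Measurable fun s : ℝ≥0 => (q n : ℝ≥0∞) * s - φ (q n) :=
        (measurable_coe_nnreal_ennreal.const_mul _).sub_const _
      exact measurableSet_lt h1 h2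
    refine ⟨SimpleFunc.piecewise _ hm (SimpleFunc.const _ (q n)) σ, fun s => ?_⟩
    by_cases hs : (σ s : ℝ≥0∞) * s - φ (σ s) < (q n : ℝ≥0∞) * s - φ (q n)
    · have hval : SimpleFunc.piecewise _ hm (SimpleFunc.const _ (q n)) σ s = q n := by
        simp [SimpleFunc.piecewise_apply, hs]
      rw [hval]
      refine ⟨(tsub_pos_iff_lt.1 (bot_le.trans_lt hs)).le, fun k hk => ?_⟩
      rcases Nat.lt_succ_iff_lt_or_eq.1 hk with hk | rfl
      · exact ((hσ s).2 k hk).trans hs.le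
      · exact le_rfl
    · have hval : SimpleFunc.piecewise _ hm (SimpleFunc.const _ (q n)) σ s = σ s := by
        simp [SimpleFunc.piecewise_apply, hs]
      rw [hval]
      refine ⟨(hσ s).1, fun k hk => ?_⟩
      rcases Nat.lt_succ_iff_lt_or_eq.1 hk with hk | rfl
      · exact (hσ s).2 k hk
      · exact not_lt.1 hs

/-- The conjugate of a continuous finite function is a supremum over a dense sequence. -/
lemma conjugate_eq_iSup_denseSeq (hcont : Continuous φ) (hfin : ∀ t : ℝ≥0, φ t < ⊤)
    (hψ : ∀ s : ℝ≥0, ψ s = ⨆ t : ℝ≥0, ((t : ℝ≥0∞) * (s : ℝ≥0∞) - φ t)) (s : ℝ≥0) :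
    ψ s = ⨆ k : ℕ, ((TopologicalSpace.denseSeq ℝ≥0 k : ℝ≥0∞) * s
      - φ (TopologicalSpace.denseSeq ℝ≥0 k)) := by
  rw [hψ]
  refine le_antisymm (iSup_le fun t => ?_)
    (iSup_le fun k => le_iSup (fun t : ℝ≥0 => (t : ℝ≥0∞) * (s : ℝ≥0∞) - φ t) _)
  have hc : Continuous fun t : ℝ≥0 => (t : ℝ≥0∞) * s - φ t := by
    refine continuous_iff_continuousAt.2 fun t => ENNReal.Tendsto.sub ?_ hcont.continuousAt
      (Or.inr (hfin t).ne)
    have : Continuous fun t : ℝ≥0 => ((t * s : ℝ≥0) : ℝ≥0∞) := by fun_prop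
    simpa only [ENNReal.coe_mul] using this.tendsto t
  refine (TopologicalSpace.denseRange_denseSeq ℝ≥0).induction_on t
    (isClosed_le hc continuous_const) fun k => ?_
  exact le_iSup (fun k : ℕ => (TopologicalSpace.denseSeq ℝ≥0 k : ℝ≥0∞) * s
    - φ (TopologicalSpace.denseSeq ℝ≥0 k)) k

lemma lintegral_conjugate_le [IsFiniteMeasure P] (hzero : φ 0 = 0) (hmono : Monotone φ)
    (hcont : Continuous φ) (hfin : ∀ t : ℝ≥0, φ t < ⊤)
    (hψ : ∀ s : ℝ≥0, ψ s = ⨆ t : ℝ≥0, ((t : ℝ≥0∞) * (s : ℝ≥0∞) - φ t))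
    {g : Ω → ℝ≥0} (hg : Measurable g) {K : ℝ≥0∞}
    (h : ∀ s : SimpleFunc Ω ℝ≥0, ∫⁻ ω, (s ω : ℝ≥0∞) * g ω ∂P ≤ K + ∫⁻ ω, φ (s ω) ∂P) :
    ∫⁻ ω, ψ (g ω) ∂P ≤ K := by
  set q := TopologicalSpace.denseSeq ℝ≥0
  let a : ℕ → Ω → ℝ≥0∞ := fun k ω => (q k : ℝ≥0∞) * g ω - φ (q k)
  have ha : ∀ k, Measurable (a k) := fun k => (hg.coe_nnreal_ennreal.const_mul _).sub_const _
  have hsup : ∀ ω, ψ (g ω) = ⨆ n : ℕ, ⨆ k ∈ Finset.range n, a k ω := by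
    intro ω
    rw [conjugate_eq_iSup_denseSeq hcont hfin hψ]
    refine le_antisymm (iSup_le fun k => ?_) (iSup_le fun n => iSup₂_le fun k _ => ?_)
    · exact le_iSup_of_le (k + 1) (le_iSup₂_of_le k (Finset.self_mem_range_succ k) le_rfl)
    · exact le_iSup (fun k => a k ω) k
  simp_rw [hsup]
  rw [lintegral_iSup]
  · refine iSup_le fun n => ?_
    obtain ⟨σ, hσ⟩ := exists_simpleFunc_maximizer hcont.measurable hzero q n
    let t : SimpleFunc Ω ℝ≥0 := σ.comp g hg
    have hφt : Measurable fun ω => φ (t ω) := hcont.measurable.comp t.measurable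
    have htop : ∫⁻ ω, φ (t ω) ∂P ≠ ⊤ := by
      obtain ⟨B, hB⟩ := (t.map ((↑) : ℝ≥0 → ℝ)).exists_forall_norm_le
      refine ((lintegral_mono (g := fun _ => φ B.toNNReal) fun ω => hmono ?_).trans_lt ?_).ne
      · exact NNReal.le_toNNReal_of_coe_le (by simpa using hB ω)
      · rw [lintegral_const]
        exact ENNReal.mul_lt_top (hfin _) (measure_lt_top _ _)
    refine (lintegral_mono fun ω => iSup₂_le fun k hk =>
      (hσ (g ω)).2 k (Finset.mem_range.1 hk)).trans ?_
    refine (ENNReal.add_le_add_iff_right htop).1 (le_trans (le_of_eq ?_) (h t))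
    rw [← lintegral_add_right _ hφt]
    exact lintegral_congr fun ω => tsub_add_cancel_of_le (hσ (g ω)).1
  · exact fun n => Measurable.biSup _ (Set.to_countable _) fun k _ => ha k
  · intro m n hmn ω
    exact biSup_mono fun k hk => Finset.range_mono hmn hk

namespace IsBoundedLinearOnHeart

variable [IsFiniteMeasure P] {F : (Ω → ℝ) → ℝ}

lemma lintegral_enorm_mul_le (hmono : Monotone φ)
    (hfin : ∀ t : ℝ≥0, φ t < ⊤) {f : Ω → ℝ} (hfm : Measurable f)
    (hfF : ∀ s : SimpleFunc Ω ℝ, Integrable (fun ω => f ω * s ω) P ∧ F s = ∫ ω, f ω * s ω ∂P)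
    {C : ℝ≥0} (hC : ∀ x ∈ orliczHeart P φ,
      ENNReal.ofReal |F x| ≤ (C : ℝ≥0∞) * luxemburgNorm P φ x) (s : SimpleFunc Ω ℝ≥0) :
    ∫⁻ ω, (s ω : ℝ≥0∞) * ‖f ω‖ₑ ∂P ≤ C * luxemburgNorm P φ (fun ω => (s ω : ℝ)) := by
  let r : SimpleFunc Ω ℝ := s.map ((↑) : ℝ≥0 → ℝ)
  have hm : MeasurableSet {ω | 0 ≤ f ω} := measurableSet_le measurable_const hfm
  let y : SimpleFunc Ω ℝ := SimpleFunc.piecewise {ω | 0 ≤ f ω} hm r (-r)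
  have hy : ∀ ω, ‖y ω‖₊ = s ω := by
    intro ω
    by_cases h : 0 ≤ f ω <;> simp [y, r, SimpleFunc.piecewise_apply, h]
  have hfy : ∀ ω, f ω * y ω = s ω * |f ω| := by
    intro ω
    by_cases h : 0 ≤ f ω
    · simp [y, r, SimpleFunc.piecewise_apply, h, abs_of_nonneg h, mul_comm]
    · simp [y, r, SimpleFunc.piecewise_apply, h, abs_of_neg (not_le.1 h), mul_comm]
  obtain ⟨hint, hFy⟩ := hfF y
  have h0 : 0 ≤ᵐ[P] fun ω => f ω * y ω :=
    Eventually.of_forall fun ω => by simp only [hfy, Pi.zero_apply]; positivity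
  have h1 := hC y (simpleFunc_mem_orliczHeart hmono hfin y)
  rw [hFy, abs_of_nonneg (integral_nonneg_of_ae h0),
    ofReal_integral_eq_lintegral_ofReal hint h0] at h1
  refine le_trans (le_of_eq (lintegral_congr fun ω => ?_)) (h1.trans ?_)
  · rw [hfy, ENNReal.ofReal_mul (NNReal.coe_nonneg _), ENNReal.ofReal_coe_nnreal,
      ← Real.norm_eq_abs, ofReal_norm]
  · gcongr
    exact luxemburgNorm_mono hmono fun ω => by simp [hy ω]

lemma density_mem_orliczSet (hF : IsBoundedLinearOnHeart P φ F) (hzero : φ 0 = 0)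
    (hmono : Monotone φ)
    (hconv : ∀ a b u v : ℝ≥0, u + v = 1 →
      φ (u * a + v * b) ≤ (u : ℝ≥0∞) * φ a + (v : ℝ≥0∞) * φ b)
    (hcont : Continuous φ) (hfin : ∀ t : ℝ≥0, φ t < ⊤)
    (hψ : ∀ s : ℝ≥0, ψ s = ⨆ t : ℝ≥0, ((t : ℝ≥0∞) * (s : ℝ≥0∞) - φ t))
    {f : Ω → ℝ} (hfm : Measurable f)
    (hfF : ∀ s : SimpleFunc Ω ℝ,
      Integrable (fun ω => f ω * s ω) P ∧ F s = ∫ ω, f ω * s ω ∂P) :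
    f ∈ orliczSet P ψ := by
  obtain ⟨C, hC⟩ := hF.bound
  have hD : 0 < C + 1 := by positivity
  refine ⟨hfm.aestronglyMeasurable, (C + 1)⁻¹, by positivity,
    lt_of_le_of_lt (lintegral_conjugate_le hzero hmono hcont hfin hψ
      (hfm.nnnorm.const_mul (C + 1)⁻¹) (K := 1) fun s => ?_) ENNReal.one_lt_top⟩
  calc ∫⁻ ω, (s ω : ℝ≥0∞) * (((C + 1)⁻¹ * ‖f ω‖₊ : ℝ≥0) : ℝ≥0∞) ∂P
      = (((C + 1)⁻¹ : ℝ≥0) : ℝ≥0∞) * ∫⁻ ω, (s ω : ℝ≥0∞) * ‖f ω‖ₑ ∂P := by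
        rw [← lintegral_const_mul' _ _ ENNReal.coe_ne_top]
        refine lintegral_congr fun ω => ?_
        rw [ENNReal.coe_mul, enorm_eq_nnnorm, mul_left_comm]
    _ ≤ (((C + 1)⁻¹ : ℝ≥0) : ℝ≥0∞) * ((C + 1 : ℝ≥0) * (1 + ∫⁻ ω, φ (s ω) ∂P)) := by
        gcongr
        refine (lintegral_enorm_mul_le hmono hfin hfm hfF hC s).trans ?_
        gcongr
        · exact le_add_of_nonneg_right zero_le_one
        · simpa using luxemburgNorm_le_one_add_lintegral (P := P) hzero hconv fun ω => (s ω : ℝ)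
    _ = 1 + ∫⁻ ω, φ (s ω) ∂P := by
        rw [← mul_assoc, ← ENNReal.coe_mul, inv_mul_cancel₀ hD.ne', ENNReal.coe_one, one_mul]

lemma eq_integral (hF : IsBoundedLinearOnHeart P φ F) (hzero : φ 0 = 0)
    (hmono : Monotone φ) (hcont : Continuous φ) (hfin : ∀ t : ℝ≥0, φ t < ⊤)
    {f x : Ω → ℝ} (hfm : AEStronglyMeasurable f P)
    (hfF : ∀ s : SimpleFunc Ω ℝ, F s = ∫ ω, f ω * s ω ∂P)
    (hx : x ∈ orliczHeart P φ) (hint : Integrable (fun ω => f ω * x ω) P) :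
    F x = ∫ ω, f ω * x ω ∂P := by
  have hxm := hx.1.stronglyMeasurable_mk.measurable
  let s : ℕ → SimpleFunc Ω ℝ := SimpleFunc.approxOn (hx.1.mk x) hxm Set.univ 0 (Set.mem_univ _)
  have hs_lim : ∀ᵐ ω ∂P, Tendsto (fun n => s n ω) atTop (𝓝 (x ω)) := by
    filter_upwards [hx.1.ae_eq_mk] with ω hω
    rw [hω]
    exact SimpleFunc.tendsto_approxOn hxm (Set.mem_univ _) (by simp)
  have hs_le : ∀ n, ∀ᵐ ω ∂P, ‖s n ω‖ ≤ 2 * ‖x ω‖ := by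
    intro n
    filter_upwards [hx.1.ae_eq_mk] with ω hω
    rw [hω, two_mul]
    exact SimpleFunc.norm_approxOn_zero_le hxm (Set.mem_univ _) ω n
  have hsub_le : ∀ n, ∀ᵐ ω ∂P, ‖(x - ⇑(s n)) ω‖₊ ≤ 3 * ‖x ω‖₊ := by
    intro n
    filter_upwards [hs_le n] with ω hω
    rw [← NNReal.coe_le_coe]
    have := norm_sub_le (x ω) (s n ω)
    simp only [Pi.sub_apply, coe_nnnorm, NNReal.coe_mul, NNReal.coe_ofNat]
    linarith
  have hsub_meas : ∀ n, AEStronglyMeasurable (x - ⇑(s n)) P :=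
    fun n => hx.1.sub (s n).stronglyMeasurable.aestronglyMeasurable
  have hsub : ∀ n, x - ⇑(s n) ∈ orliczHeart P φ := fun n =>
    mem_orliczHeart_of_nnnorm_le hmono hx (hsub_meas n) three_pos (hsub_le n)
  have h0 : Tendsto (fun n => F (x - ⇑(s n))) atTop (𝓝 0) := by
    refine hF.tendsto_zero hsub fun c hc => ?_
    have := tendsto_lintegral_filter_of_dominated_convergence' (μ := P) (l := atTop)
      (F := fun n ω => φ (c * ‖(x - ⇑(s n)) ω‖₊)) (f := fun _ => 0)
      (fun ω => φ (c * 3 * ‖x ω‖₊))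
      (Eventually.of_forall fun n =>
        hcont.measurable.comp_aemeasurable ((hsub_meas n).aemeasurable.nnnorm.const_mul c))
      (Eventually.of_forall fun n => by
        filter_upwards [hsub_le n] with ω hω
        exact hmono (by rw [mul_assoc]; gcongr))
      (hx.2 (c * 3) (by positivity)).ne ?_
    · simpa using this
    · filter_upwards [hs_lim] with ω hω
      have hcc : Continuous fun r : ℝ => φ (c * ‖x ω - r‖₊) := by fun_prop
      simpa [hzero, Function.comp_def] using (hcc.tendsto (x ω)).comp hω
  have h1 : Tendsto (fun n => F (s n)) atTop (𝓝 (∫ ω, f ω * x ω ∂P)) := by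
    simp only [hfF]
    refine tendsto_integral_of_dominated_convergence (fun ω => 2 * ‖f ω * x ω‖)
      (fun n => hfm.mul (s n).stronglyMeasurable.aestronglyMeasurable) (hint.norm.const_mul 2)
      (fun n => ?_) ?_
    · filter_upwards [hs_le n] with ω hω
      rw [norm_mul, norm_mul, mul_left_comm]
      gcongr
    · filter_upwards [hs_lim] with ω hω using hω.const_mul _
  have h2 := h0.add h1
  rw [zero_add] at h2
  refine tendsto_nhds_unique (tendsto_const_nhds.congr fun n => ?_) h2
  rw [← hF.add _ (hsub n) _ (simpleFunc_mem_orliczHeart hmono hfin (s n)), sub_add_cancel]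

end IsBoundedLinearOnHeart

lemma ae_eq_of_integral_mul_eq [IsFiniteMeasure P] (hmono : Monotone φ)
    (hfin : ∀ t : ℝ≥0, φ t < ⊤)
    (hψ : ∀ s : ℝ≥0, ψ s = ⨆ t : ℝ≥0, ((t : ℝ≥0∞) * (s : ℝ≥0∞) - φ t))
    {f g : Ω → ℝ} (hf : f ∈ orliczSet P ψ) (hg : g ∈ orliczSet P ψ)
    (h : ∀ x ∈ orliczHeart P φ, ∫ ω, f ω * x ω ∂P = ∫ ω, g ω * x ω ∂P) : f =ᵐ[P] g := by
  have hint : ∀ f ∈ orliczSet P ψ, Integrable f P := by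
    intro f hf
    simpa using integrable_mul_of_mem_orliczSet hmono hψ hf (orliczHeart_subset_orliczSet
      (indicator_one_mem_orliczHeart (P := P) hmono hfin MeasurableSet.univ))
  refine Integrable.ae_eq_of_forall_setIntegral_eq f g (hint f hf) (hint g hg) fun A hA _ => ?_
  have := h _ (indicator_one_mem_orliczHeart hmono hfin hA)
  simpa [← Set.indicator_mul_right, integral_indicator hA] using this

end OrliczDuality

/-- dual representation for the Orlicz heart of a probability space: the
map `T f : x ↦ ∫ f x dP` is an isometric isomorphism of `(L^ψ, |·|_{ψO})` onto the
continuous dual of `(H^φ, |·|_{φL})`, where `ψ` is the conjugate of `φ`. -/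
theorem orlicz_heart_dual_representation
    {Ω : Type*} [MeasurableSpace Ω] (P : Measure Ω) [IsProbabilityMeasure P]
    (φ : ℝ≥0 → ℝ≥0∞)
    (hzero : φ 0 = 0)
    (hmono : Monotone φ)
    (hconv : ∀ a b u v : ℝ≥0, u + v = 1 →
      φ (u * a + v * b) ≤ (u : ℝ≥0∞) * φ a + (v : ℝ≥0∞) * φ b)
    (hcont : Continuous φ)
    (hnt₁ : ∃ a : ℝ≥0, 0 < a ∧ 0 < φ a)
    (hfin : ∀ t : ℝ≥0, φ t < ⊤)
    (ψ : ℝ≥0 → ℝ≥0∞)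
    (hψ : ∀ s : ℝ≥0, ψ s = ⨆ t : ℝ≥0, ((t : ℝ≥0∞) * (s : ℝ≥0∞) - φ t)) :
    -- (i)  each `f ∈ L^ψ` induces a bounded linear functional on `H^φ`
    --      whose operator norm is `|f|_{ψO}` :
    (∀ f ∈ orliczSet P ψ,
      (∀ x ∈ orliczHeart P φ, Integrable (fun ω => f ω * x ω) P) ∧
      (∀ x ∈ orliczHeart P φ,
        ENNReal.ofReal |∫ ω, f ω * x ω ∂P| ≤
          orliczDualNorm P φ f * luxemburgNorm P φ x) ∧
      sSup {r : ℝ≥0∞ | ∃ x ∈ orliczHeart P φ, luxemburgNorm P φ x ≤ 1 ∧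
          r = ENNReal.ofReal |∫ ω, f ω * x ω ∂P|} = orliczDualNorm P φ f) ∧
    -- (ii) every bounded linear functional on `H^φ` is represented by a unique
    --      (up to a.e. equality) `f ∈ L^ψ` :
    (∀ F : (Ω → ℝ) → ℝ,
      (∀ x ∈ orliczHeart P φ, ∀ y ∈ orliczHeart P φ, F (x + y) = F x + F y) →
      (∀ a : ℝ, ∀ x ∈ orliczHeart P φ, F (a • x) = a * F x) →
      (∃ C : ℝ≥0, ∀ x ∈ orliczHeart P φ,
        ENNReal.ofReal |F x| ≤ (C : ℝ≥0∞) * luxemburgNorm P φ x) →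
      ∃ f ∈ orliczSet P ψ,
        (∀ x ∈ orliczHeart P φ,
          Integrable (fun ω => f ω * x ω) P ∧ F x = ∫ ω, f ω * x ω ∂P) ∧
        ∀ g ∈ orliczSet P ψ,
          (∀ x ∈ orliczHeart P φ, F x = ∫ ω, g ω * x ω ∂P) → g =ᵐ[P] f) := by
  refine ⟨fun f hf => ⟨fun x hx => integrable_mul_of_mem_orliczSet hmono hψ hf
      (orliczHeart_subset_orliczSet hx),
    fun x hx => ofReal_abs_integral_le_orliczDualNorm_mul hzero hmono hconv hψ hf hx,
    sSup_orliczHeart_eq_orliczDualNorm hmono hfin hψ hf⟩, fun F hadd hsmul hbound => ?_⟩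
  have hF : IsBoundedLinearOnHeart P φ F := ⟨hadd, hsmul, hbound⟩
  obtain ⟨f, hfm, hfi, hfA⟩ := hF.exists_density hzero hmono hfin
  have hfF := hF.map_simpleFunc hmono hfin hfi hfA
  have hf : f ∈ orliczSet P ψ := hF.density_mem_orliczSet hzero hmono hconv hcont hfin hψ hfm hfF
  have hrep : ∀ x ∈ orliczHeart P φ,
      Integrable (fun ω => f ω * x ω) P ∧ F x = ∫ ω, f ω * x ω ∂P := by
    intro x hx
    have hint := integrable_mul_of_mem_orliczSet hmono hψ hf (orliczHeart_subset_orliczSet hx)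
    exact ⟨hint, hF.eq_integral hzero hmono hcont hfin hf.1 (fun s => (hfF s).2) hx hint⟩
  exact ⟨f, hf, hrep, fun g hg hgF => ae_eq_of_integral_mul_eq hmono hfin hψ hg hf
    fun x hx => (hgF x hx).symm.trans (hrep x hx).2⟩
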